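/- arXiv:2309.09451 — 7 statements merged into one kernel-verified Lean document; each statement's English description precedes it below -/
import Mathlib

section
/- The system E^{∇•} is sound and strongly complete with respect to the class of all neighborhood frames: for every set Γ ∪ {φ} of L(∇,•)-formulas, Γ ⊢_{E^{∇•}} φ if and only if every pointed neighborhood model (M,s) satisfying all members of Γ also satisfies φ. -/
/-- The language L(∇,•) over propositional variables indexed by ℕ. -/
inductive Formula : Type
  | atom : ℕ → Formula
  | neg : Formula → Formula
  | and : Formula → Formula → Formula
  | nabla : Formula → Formula
  | bullet : Formula → Formula

namespace Formula

/-- Disjunction, defined from ¬ and ∧ as usual. -/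
def or (φ ψ : Formula) : Formula := neg ((neg φ).and (neg ψ))

/-- Implication, defined from ¬ and ∧ as usual. -/
def imp (φ ψ : Formula) : Formula := (neg φ).or ψ

/-- Biimplication, defined from ¬ and ∧ as usual. -/
def biimp (φ ψ : Formula) : Formula := (φ.imp ψ).and (ψ.imp φ)

/-- A fixed tautology ⊤. -/
def top : Formula := (atom 0).imp (atom 0)

/-- Δφ := ¬∇φ. -/
def delta (φ : Formula) : Formula := neg (nabla φ)

/-- ∘φ := ¬•φ. -/
def circ (φ : Formula) : Formula := neg (bullet φ)

end Formula

/-- A neighborhood model. -/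
structure NbhdModel : Type 1 where
  S : Type
  ne : Nonempty S
  N : S → Set (Set S)
  V : ℕ → Set S

namespace NbhdModel

/-- The truth set ⟦φ⟧_M of a formula in a neighborhood model. -/
def truthSet (M : NbhdModel) : Formula → Set M.S
  | .atom p => M.V p
  | .neg φ => (M.truthSet φ)ᶜ
  | .and φ ψ => M.truthSet φ ∩ M.truthSet ψ
  | .nabla φ => {s | M.truthSet φ ∉ M.N s ∧ (M.truthSet φ)ᶜ ∉ M.N s}
  | .bullet φ => {s | s ∈ M.truthSet φ ∧ M.truthSet φ ∉ M.N s}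

/-- M,s ⊨ φ. -/
def Sat (M : NbhdModel) (s : M.S) (φ : Formula) : Prop := s ∈ M.truthSet φ

/-- Property (n): N(s) contains the unit. -/
def PropN (M : NbhdModel) : Prop := ∀ s : M.S, (Set.univ : Set M.S) ∈ M.N s

/-- Property (r): N(s) contains its core. -/
def PropR (M : NbhdModel) : Prop := ∀ s : M.S, ⋂₀ (M.N s) ∈ M.N s

/-- Property (i): N(s) is closed under binary intersections. -/
def PropI (M : NbhdModel) : Prop :=
  ∀ (s : M.S) (X Y : Set M.S), X ∈ M.N s → Y ∈ M.N s → X ∩ Y ∈ M.N s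

/-- Property (s): N(s) is supplemented (closed under supersets). -/
def PropS (M : NbhdModel) : Prop :=
  ∀ (s : M.S) (X Y : Set M.S), X ∈ M.N s → X ⊆ Y → Y ∈ M.N s

/-- Property (c): N(s) is closed under complements. -/
def PropC (M : NbhdModel) : Prop :=
  ∀ (s : M.S) (X : Set M.S), X ∈ M.N s → Xᶜ ∈ M.N s

/-- Property (d). -/
def PropD (M : NbhdModel) : Prop :=
  ∀ (s : M.S) (X : Set M.S), X ∈ M.N s → Xᶜ ∉ M.N s

/-- Property (t). -/
def PropT (M : NbhdModel) : Prop :=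
  ∀ (s : M.S) (X : Set M.S), X ∈ M.N s → s ∈ X

/-- Property (b). -/
def PropB (M : NbhdModel) : Prop :=
  ∀ (s : M.S) (X : Set M.S), s ∈ X → {u : M.S | Xᶜ ∉ M.N u} ∈ M.N s

/-- Property (4). -/
def Prop4 (M : NbhdModel) : Prop :=
  ∀ (s : M.S) (X : Set M.S), X ∈ M.N s → {u : M.S | X ∈ M.N u} ∈ M.N s

/-- Property (5). -/
def Prop5 (M : NbhdModel) : Prop :=
  ∀ (s : M.S) (X : Set M.S), X ∉ M.N s → {u : M.S | X ∉ M.N u} ∈ M.N s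

end NbhdModel

/-- φ is an instance of a propositional tautology (treating ∇ψ and •ψ subformulas
as atoms): every Boolean valuation that respects ¬ and ∧ makes φ true. -/
def IsTautology (φ : Formula) : Prop :=
  ∀ v : Formula → Bool,
    (∀ ψ : Formula, v ψ.neg = !v ψ) →
    (∀ ψ χ : Formula, v (ψ.and χ) = (v ψ && v χ)) →
    v φ = true

/-- Theorems of the system E^{∇•} extended with the extra axioms in `Ax`:
all tautology instances, E1, E2, E3, the members of `Ax`, closed under
modus ponens, RE∇ and RE•. -/
inductive Prf (Ax : Set Formula) : Formula → Prop
  | taut {φ : Formula} : IsTautology φ → Prf Ax φ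
  | e1 (φ : Formula) : Prf Ax ((Formula.nabla φ).biimp (Formula.nabla φ.neg))
  | e2 (φ : Formula) : Prf Ax ((Formula.bullet φ).imp φ)
  | e3 (φ : Formula) :
      Prf Ax ((Formula.nabla φ).imp ((Formula.bullet φ).or (Formula.bullet φ.neg)))
  | ax {φ : Formula} : φ ∈ Ax → Prf Ax φ
  | mp {φ ψ : Formula} : Prf Ax (φ.imp ψ) → Prf Ax φ → Prf Ax ψ
  | reN {φ ψ : Formula} :
      Prf Ax (φ.biimp ψ) → Prf Ax ((Formula.nabla φ).biimp (Formula.nabla ψ))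
  | reB {φ ψ : Formula} :
      Prf Ax (φ.biimp ψ) → Prf Ax ((Formula.bullet φ).biimp (Formula.bullet ψ))

/-- Γ ⊢_Λ φ: derivable from theorems of the system together with members of Γ
by modus ponens. -/
inductive Deriv (Ax : Set Formula) (Γ : Set Formula) : Formula → Prop
  | thm {φ : Formula} : Prf Ax φ → Deriv Ax Γ φ
  | prem {φ : Formula} : φ ∈ Γ → Deriv Ax Γ φ
  | mp {φ ψ : Formula} : Deriv Ax Γ (φ.imp ψ) → Deriv Ax Γ φ → Deriv Ax Γ ψ

/-- No extra axioms: the system E^{∇•}. -/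
def EAx : Set Formula := ∅

/-- Extra axiom E4: •φ → ∇φ (all instances); E^{∇•} plus these is E_c^{∇•}. -/
def EcAx : Set Formula := {α | ∃ φ : Formula, α = (Formula.bullet φ).imp (Formula.nabla φ)}

/-- Extra axiom ∘⊤; E^{∇•} plus this is EN^{∇•}. -/
def ENAx : Set Formula := {Formula.top.bullet.neg}

/-- Extra axioms M1–M4 (all instances); E^{∇•} plus these is M^{∇•}. -/
def MAx : Set Formula :=
  {α | ∃ φ ψ χ : Formula,
      α = ((Formula.nabla (φ.or ψ)).and (Formula.nabla (φ.neg.or χ))).imp (Formula.nabla φ)} ∪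
  {α | ∃ φ ψ χ : Formula,
      α = ((Formula.bullet (φ.or ψ)).and (Formula.bullet (φ.neg.or χ))).imp (Formula.nabla φ)} ∪
  {α | ∃ φ ψ χ : Formula,
      α = ((Formula.bullet (φ.or ψ)).and (Formula.nabla (φ.neg.or χ))).imp (Formula.nabla φ)} ∪
  {α | ∃ φ ψ : Formula,
      α = (φ.circ.and φ).imp ((Formula.delta (φ.or ψ)).and (Formula.circ (φ.or ψ)))}

/-- Extra axioms of R^{∇•}: those of M^{∇•} plus R1 and R2 (all instances). -/
def RAx : Set Formula :=
  MAx ∪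
  {α | ∃ φ ψ : Formula,
      α = ((Formula.delta φ).and (Formula.delta ψ)).imp (Formula.delta (φ.and ψ))} ∪
  {α | ∃ φ ψ : Formula,
      α = ((Formula.circ φ).and (Formula.circ ψ)).imp (Formula.circ (φ.and ψ))}

/-- Extra axioms of K^{∇•}: those of R^{∇•} plus ∘⊤. -/
def KAx : Set Formula := RAx ∪ {Formula.top.bullet.neg}

namespace NbhdModel

variable {M : NbhdModel} {s : M.S}

theorem truthSet_or (φ ψ : Formula) :
    M.truthSet (φ.or ψ) = M.truthSet φ ∪ M.truthSet ψ := by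
  simp [Formula.or, truthSet, Set.compl_inter]

theorem sat_imp {φ ψ : Formula} : M.Sat s (φ.imp ψ) ↔ (M.Sat s φ → M.Sat s ψ) := by
  simp only [Sat, Formula.imp, truthSet_or, truthSet, Set.mem_union, Set.mem_compl_iff]
  tauto

theorem sat_biimp {φ ψ : Formula} : M.Sat s (φ.biimp ψ) ↔ (M.Sat s φ ↔ M.Sat s ψ) :=
  (and_congr sat_imp sat_imp).trans iff_iff_implies_and_implies.symm

theorem truthSet_eq_of_forall_sat_biimp {φ ψ : Formula} (h : ∀ s, M.Sat s (φ.biimp ψ)) :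
    M.truthSet φ = M.truthSet ψ :=
  Set.ext fun s => sat_biimp.1 (h s)

theorem sat_of_isTautology {φ : Formula} (h : IsTautology φ) : M.Sat s φ := by
  classical
  exact of_decide_eq_true <| h (fun χ => decide (s ∈ M.truthSet χ))
    (fun ψ => by simp [truthSet]) (fun ψ χ => by simp [truthSet])

end NbhdModel

theorem Prf.sound {φ : Formula} (h : Prf EAx φ) (M : NbhdModel) (s : M.S) : M.Sat s φ := by
  induction h generalizing s with
  | taut h => exact NbhdModel.sat_of_isTautology h
  | e1 φ =>
    rw [NbhdModel.sat_biimp]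
    simp only [NbhdModel.Sat, NbhdModel.truthSet, Set.mem_ofPred_eq, compl_compl]
    exact and_comm
  | e2 φ => exact NbhdModel.sat_imp.2 fun h => h.1
  | e3 φ =>
    rw [NbhdModel.sat_imp]
    simp only [NbhdModel.Sat, NbhdModel.truthSet_or, NbhdModel.truthSet, Set.mem_ofPred_eq,
      Set.mem_union, Set.mem_compl_iff]
    tauto
  | ax h => exact h.elim
  | mp _ _ ih₁ ih₂ => exact NbhdModel.sat_imp.1 (ih₁ s) (ih₂ s)
  | reN _ ih =>
    rw [NbhdModel.sat_biimp]
    simp only [NbhdModel.Sat, NbhdModel.truthSet, NbhdModel.truthSet_eq_of_forall_sat_biimp ih]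
  | reB _ ih =>
    rw [NbhdModel.sat_biimp]
    simp only [NbhdModel.Sat, NbhdModel.truthSet, NbhdModel.truthSet_eq_of_forall_sat_biimp ih]

theorem Deriv.sound {Γ : Set Formula} {φ : Formula} (h : Deriv EAx Γ φ) (M : NbhdModel) (s : M.S)
    (hs : ∀ γ ∈ Γ, M.Sat s γ) : M.Sat s φ := by
  induction h with
  | thm h => exact h.sound M s
  | prem h => exact hs _ h
  | mp _ _ ih₁ ih₂ => exact NbhdModel.sat_imp.1 ih₁ ih₂

/-- A Boolean valuation of formulas: it commutes with negation and conjunction. -/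
structure IsBoolVal (v : Formula → Bool) : Prop where
  neg : ∀ ψ : Formula, v ψ.neg = !v ψ
  and : ∀ ψ χ : Formula, v (ψ.and χ) = (v ψ && v χ)

namespace IsBoolVal

variable {v : Formula → Bool}

theorem or (hv : IsBoolVal v) (φ ψ : Formula) : v (φ.or ψ) = (v φ || v ψ) := by
  simp [Formula.or, hv.neg, hv.and]

theorem imp (hv : IsBoolVal v) (φ ψ : Formula) : v (φ.imp ψ) = (!v φ || v ψ) := by
  simp [Formula.imp, hv.or, hv.neg]

theorem biimp (hv : IsBoolVal v) (φ ψ : Formula) : v (φ.biimp ψ) = (v φ == v ψ) := by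
  rw [Formula.biimp, hv.and, hv.imp, hv.imp]
  cases v φ <;> cases v ψ <;> rfl

end IsBoolVal

namespace Deriv

variable {Ax Γ Δ : Set Formula} {φ ψ χ : Formula}

theorem of_boolVal (h : ∀ v, IsBoolVal v → v φ = true) : Deriv Ax Γ φ :=
  .thm (.taut fun v hn ha => h v ⟨hn, ha⟩)

theorem deduction (h : Deriv Ax (insert ψ Γ) φ) : Deriv Ax Γ (ψ.imp φ) := by
  have weaken : ∀ {χ}, Deriv Ax Γ χ → Deriv Ax Γ (ψ.imp χ) := fun {χ} h => by
    refine .mp (of_boolVal fun v hv => ?_) h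
    simp only [hv.imp]
    cases v χ <;> simp
  induction h with
  | thm h => exact weaken (.thm h)
  | prem h =>
    rcases h with rfl | h
    · exact of_boolVal fun v hv => by simp [hv.imp]
    · exact weaken (.prem h)
  | @mp α β _ _ ih₁ ih₂ =>
    refine .mp (.mp (of_boolVal fun v hv => ?_) ih₁) ih₂
    simp only [hv.imp]
    cases v ψ <;> cases v α <;> cases v β <;> rfl

theorem mono (hΓ : Γ ⊆ Δ) (h : Deriv Ax Γ φ) : Deriv Ax Δ φ := by
  induction h with
  | thm h => exact .thm h
  | prem h => exact .prem (hΓ h)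
  | mp _ _ ih₁ ih₂ => exact .mp ih₁ ih₂

theorem exists_mem_of_sUnion {c : Set (Set Formula)} (hc : IsChain (· ⊆ ·) c) (hne : c.Nonempty)
    (h : Deriv Ax (⋃₀ c) φ) : ∃ T ∈ c, Deriv Ax T φ := by
  induction h with
  | thm h => exact hne.imp fun T hT => ⟨hT, .thm h⟩
  | prem h =>
    obtain ⟨T, hT, hφ⟩ := h
    exact ⟨T, hT, .prem hφ⟩
  | mp _ _ ih₁ ih₂ =>
    obtain ⟨T₁, hT₁, h₁⟩ := ih₁
    obtain ⟨T₂, hT₂, h₂⟩ := ih₂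
    rcases hc.total hT₁ hT₂ with h | h
    · exact ⟨T₂, hT₂, .mp (h₁.mono h) h₂⟩
    · exact ⟨T₁, hT₁, .mp h₁ (h₂.mono h)⟩

/-- Lindenbaum's lemma, with the maximal set presented as a Boolean valuation. -/
theorem exists_boolVal_of_not (h : ¬ Deriv Ax Γ φ) :
    ∃ v, IsBoolVal v ∧ (∀ ψ, Prf Ax ψ → v ψ = true) ∧ (∀ γ ∈ Γ, v γ = true) ∧ v φ = false := by
  classical
  obtain ⟨T, hΓT, hT⟩ := zorn_subset_nonempty {T | ¬ Deriv Ax T φ}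
    (fun c hc hchain hne => ⟨⋃₀ c, fun hφ => by
      obtain ⟨T, hTc, hTφ⟩ := exists_mem_of_sUnion hchain hne hφ
      exact hc hTc hTφ, fun T hTc => Set.subset_sUnion_of_mem hTc⟩) Γ h
  have hTφ : ¬ Deriv Ax T φ := hT.prop
  have imp_of_notMem : ∀ {ψ}, ψ ∉ T → Deriv Ax T (ψ.imp φ) := fun {ψ} hψ => by
    by_contra hcon
    exact hψ (hT.le_of_ge (y := insert ψ T) (fun hd => hcon hd.deduction)
      (Set.subset_insert ψ T) (Set.mem_insert ψ T))
  have closed : ∀ {ψ}, Deriv Ax T ψ → ψ ∈ T := fun {ψ} hψ => by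
    by_contra hcon
    exact hTφ (.mp (imp_of_notMem hcon) hψ)
  have mem_neg : ∀ ψ : Formula, ψ.neg ∈ T ↔ ψ ∉ T := fun ψ => by
    constructor
    · intro hn hp
      refine hTφ (.mp (.mp (of_boolVal fun v hv => ?_) (.prem hn)) (.prem hp))
      simp only [hv.imp, hv.neg]
      cases v ψ <;> simp
    · intro hp
      by_contra hn
      refine hTφ (.mp (.mp (of_boolVal fun v hv => ?_) (imp_of_notMem hn)) (imp_of_notMem hp))
      simp only [hv.imp, hv.neg]
      cases v ψ <;> cases v φ <;> rfl
  have mem_and : ∀ ψ χ : Formula, ψ.and χ ∈ T ↔ ψ ∈ T ∧ χ ∈ T := fun ψ χ => by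
    refine ⟨fun h => ⟨closed (.mp (of_boolVal fun v hv => ?_) (.prem h)),
      closed (.mp (of_boolVal fun v hv => ?_) (.prem h))⟩, fun h =>
      closed (.mp (.mp (of_boolVal fun v hv => ?_) (.prem h.1)) (.prem h.2))⟩ <;>
    · simp only [hv.imp, hv.and]
      cases v ψ <;> cases v χ <;> rfl
  exact ⟨fun ψ => decide (ψ ∈ T), ⟨fun ψ => by simp [mem_neg], fun ψ χ => by simp [mem_and]⟩,
    fun ψ hψ => by simpa using closed (.thm hψ), fun γ hγ => by simpa using hΓT hγ,
    by simpa using fun hφ => hTφ (.prem hφ)⟩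

end Deriv

theorem Prf.of_deriv_empty {Ax : Set Formula} {φ : Formula} (h : Deriv Ax ∅ φ) : Prf Ax φ := by
  induction h with
  | thm h => exact h
  | prem h => exact h.elim
  | mp _ _ ih₁ ih₂ => exact .mp ih₁ ih₂

/-- Canonical worlds: Boolean valuations verifying every theorem of the system. -/
def CanonicalWorld (Ax : Set Formula) : Type :=
  {v : Formula → Bool // IsBoolVal v ∧ ∀ ψ, Prf Ax ψ → v ψ = true}

namespace CanonicalWorld

variable {Ax : Set Formula}

/-- The set of canonical worlds verifying a formula. -/
def proofSet (Ax : Set Formula) (φ : Formula) : Set (CanonicalWorld Ax) :=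
  {w | w.1 φ = true}

theorem prf_biimp_of_proofSet_eq {φ ψ : Formula} (h : proofSet Ax φ = proofSet Ax ψ) :
    Prf Ax (φ.biimp ψ) := by
  refine Prf.of_deriv_empty (not_not.1 fun hnot => ?_)
  obtain ⟨v, hv, hthm, -, hφ⟩ := Deriv.exists_boolVal_of_not hnot
  have hw : v φ = true ↔ v ψ = true := Set.ext_iff.1 h ⟨v, hv, hthm⟩
  rw [hv.biimp, Bool.eq_iff_iff.2 hw] at hφ
  simp at hφ

theorem proofSet_neg (φ : Formula) : proofSet Ax φ.neg = (proofSet Ax φ)ᶜ := by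
  ext w
  simp [proofSet, w.2.1.neg]

/-- Canonical neighborhoods: the proof sets of `φ` for which neither `∇φ` nor `•φ` holds. -/
def nbhd (w : CanonicalWorld Ax) : Set (Set (CanonicalWorld Ax)) :=
  {X | ∃ φ : Formula, X = proofSet Ax φ ∧ w.1 φ.nabla = false ∧ w.1 φ.bullet = false}

theorem proofSet_mem_nbhd {w : CanonicalWorld Ax} {φ : Formula} :
    proofSet Ax φ ∈ w.nbhd ↔ w.1 φ.nabla = false ∧ w.1 φ.bullet = false := by
  refine ⟨?_, fun h => ⟨φ, rfl, h⟩⟩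
  rintro ⟨ψ, hX, hN, hB⟩
  have hprf := prf_biimp_of_proofSet_eq hX
  have h₁ := w.2.2 _ (.reN hprf)
  have h₂ := w.2.2 _ (.reB hprf)
  simp only [w.2.1.biimp, beq_iff_eq] at h₁ h₂
  exact ⟨h₁.trans hN, h₂.trans hB⟩

end CanonicalWorld

/-- The canonical model. -/
def canonicalModel (Ax : Set Formula) (ne : Nonempty (CanonicalWorld Ax)) : NbhdModel where
  S := CanonicalWorld Ax
  ne := ne
  N := CanonicalWorld.nbhd
  V p := CanonicalWorld.proofSet Ax (.atom p)

theorem canonicalModel_truthSet {Ax : Set Formula} (ne : Nonempty (CanonicalWorld Ax))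
    (φ : Formula) : (canonicalModel Ax ne).truthSet φ = CanonicalWorld.proofSet Ax φ := by
  induction φ with
  | atom p => rfl
  | neg φ ih =>
    rw [NbhdModel.truthSet, ih]
    exact (CanonicalWorld.proofSet_neg φ).symm
  | and φ ψ ih₁ ih₂ =>
    rw [NbhdModel.truthSet, ih₁, ih₂]
    ext (w : CanonicalWorld Ax)
    change w.1 φ = true ∧ w.1 ψ = true ↔ w.1 (φ.and ψ) = true
    rw [w.2.1.and, Bool.and_eq_true]
  | nabla φ ih =>
    rw [NbhdModel.truthSet, ih]
    ext (w : CanonicalWorld Ax)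
    change CanonicalWorld.proofSet Ax φ ∉ w.nbhd ∧ (CanonicalWorld.proofSet Ax φ)ᶜ ∉ w.nbhd ↔
      w.1 φ.nabla = true
    have h₁ := w.2.2 _ (.e1 φ)
    have h₂ := w.2.2 _ (.e2 φ)
    have h₃ := w.2.2 _ (.e2 φ.neg)
    rw [← CanonicalWorld.proofSet_neg, CanonicalWorld.proofSet_mem_nbhd,
      CanonicalWorld.proofSet_mem_nbhd]
    simp only [w.2.1.biimp, w.2.1.imp, w.2.1.neg] at h₁ h₂ h₃
    revert h₁ h₂ h₃
    cases w.1 φ <;> cases w.1 φ.nabla <;> cases w.1 φ.neg.nabla <;> cases w.1 φ.bullet <;>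
      cases w.1 φ.neg.bullet <;> simp
  | bullet φ ih =>
    rw [NbhdModel.truthSet, ih]
    ext (w : CanonicalWorld Ax)
    change w.1 φ = true ∧ CanonicalWorld.proofSet Ax φ ∉ w.nbhd ↔ w.1 φ.bullet = true
    have h₁ := w.2.2 _ (.e2 φ)
    have h₂ := w.2.2 _ (.e2 φ.neg)
    have h₃ := w.2.2 _ (.e3 φ)
    rw [CanonicalWorld.proofSet_mem_nbhd]
    simp only [w.2.1.imp, w.2.1.or, w.2.1.neg] at h₁ h₂ h₃
    revert h₁ h₂ h₃
    cases w.1 φ <;> cases w.1 φ.nabla <;> cases w.1 φ.bullet <;> cases w.1 φ.neg.bullet <;> simp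

/-- E^{∇•} is sound and strongly complete with respect to the
class of all neighborhood frames. -/
theorem E_sound_and_strongly_complete (Γ : Set Formula) (φ : Formula) :
    Deriv EAx Γ φ ↔
      ∀ (M : NbhdModel) (s : M.S), (∀ γ ∈ Γ, M.Sat s γ) → M.Sat s φ := by
  refine ⟨fun h M s => h.sound M s, fun h => not_not.1 fun hnot => ?_⟩
  obtain ⟨v, hv, hthm, hΓ, hφ⟩ := Deriv.exists_boolVal_of_not hnot
  let w : CanonicalWorld EAx := ⟨v, hv, hthm⟩
  have sat_iff : ∀ ψ, (canonicalModel EAx ⟨w⟩).Sat w ψ ↔ v ψ = true := fun ψ =>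
    Set.ext_iff.1 (canonicalModel_truthSet ⟨w⟩ ψ) w
  have hsat := (sat_iff φ).1 (h (canonicalModel EAx ⟨w⟩) w fun γ hγ => (sat_iff γ).2 (hΓ γ hγ))
  simp [hφ] at hsat
end

section
/- For all L(∇,•)-formulas φ and ψ, the formula •((∘φ ∨ ψ) → φ) → φ is a theorem of the system E^{∇•}, where ∘φ abbreviates ¬•φ. -/
/-- •((∘φ ∨ ψ) → φ) → φ is a theorem of E^{∇•}. -/
theorem bullet_of_circ_or_implies (φ ψ : Formula) :
    Prf EAx ((Formula.bullet ((φ.circ.or ψ).imp φ)).imp φ) := by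
  have h : IsTautology ((φ.bullet.imp φ).imp
      ((((φ.circ.or ψ).imp φ).bullet.imp ((φ.circ.or ψ).imp φ)).imp
        (((φ.circ.or ψ).imp φ).bullet.imp φ))) := by
    intro v hneg hand
    generalize hX : ((φ.circ.or ψ).imp φ).bullet = X
    simp only [Formula.imp, Formula.or, Formula.circ, hneg, hand]
    cases v φ <;> cases v ψ <;> cases v φ.bullet <;> cases v X <;> rfl
  exact .mp (.mp (.taut h) (.e2 φ)) (.e2 _)
end

section
/- Over (c)-models, the modalities ∇ and • are interdefinable: for every (c)-model M, every state s of M, and every L(∇,•)-formula φ, (i) M,s ⊨ •φ if and only if M,s ⊨ φ ∧ ∇φ, and (ii) M,s ⊨ ∇φ if and only if M,s ⊨ •φ ∨ •¬φ. -/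
theorem NbhdModel.PropC.compl_mem_iff {M : NbhdModel} (hc : M.PropC) (s : M.S) (X : Set M.S) :
    Xᶜ ∈ M.N s ↔ X ∈ M.N s :=
  ⟨fun h => compl_compl X ▸ hc s Xᶜ h, hc s X⟩

/-- over (c)-models, ∇ and • are interdefinable. -/
theorem interdefinable_over_c_models (M : NbhdModel) (hc : M.PropC)
    (s : M.S) (φ : Formula) :
    (M.Sat s (Formula.bullet φ) ↔ M.Sat s (φ.and (Formula.nabla φ))) ∧
    (M.Sat s (Formula.nabla φ) ↔
      M.Sat s ((Formula.bullet φ).or (Formula.bullet φ.neg))) := by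
  simp only [NbhdModel.Sat, NbhdModel.truthSet, Formula.or, Set.mem_inter_iff,
    Set.mem_compl_iff, Set.mem_ofPred_eq, hc.compl_mem_iff]
  tauto
end

section
/- Over (t)-models, the modalities ∇ and • are interdefinable: for every (t)-model M, every state s of M, and every L(∇,•)-formula φ, (i) M,s ⊨ •φ if and only if M,s ⊨ φ ∧ ∇φ, and (ii) M,s ⊨ ∇φ if and only if M,s ⊨ •φ ∨ •¬φ. -/
/-- over (t)-models, ∇ and • are interdefinable. -/
theorem interdefinable_over_t_models (M : NbhdModel) (ht : M.PropT)
    (s : M.S) (φ : Formula) :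
    (M.Sat s (Formula.bullet φ) ↔ M.Sat s (φ.and (Formula.nabla φ))) ∧
    (M.Sat s (Formula.nabla φ) ↔
      M.Sat s ((Formula.bullet φ).or (Formula.bullet φ.neg))) := by
  have h₁ := ht s (M.truthSet φ)
  have h₂ := ht s (M.truthSet φ)ᶜ
  simp only [NbhdModel.Sat, Formula.or, NbhdModel.truthSet, Set.mem_compl_iff,
    Set.mem_inter_iff, Set.mem_ofPred_eq] at *
  tauto
end

section
/- The language L(•) is not at least as expressive as the language L(∇) over the class of all neighborhood models, nor over the class of (r)-models, nor over the class of (i)-models, nor over the class of (s)-models, nor over the class of (d)-models: for each such class C there exists an L(•)-formula φ such that no L(∇)-formula ψ satisfies M,s ⊨ φ ⟺ M,s ⊨ ψ for all models M ∈ C and all states s of M. -/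
namespace Formula

/-- Membership in the fragment L(∇): no occurrence of •. -/
def bulletFree : Formula → Prop
  | .atom _ => True
  | .neg φ => φ.bulletFree
  | .and φ ψ => φ.bulletFree ∧ ψ.bulletFree
  | .nabla φ => φ.bulletFree
  | .bullet _ => False

/-- Membership in the fragment L(•): no occurrence of ∇. -/
def nablaFree : Formula → Prop
  | .atom _ => True
  | .neg φ => φ.nablaFree
  | .and φ ψ => φ.nablaFree ∧ ψ.nablaFree
  | .nabla _ => False
  | .bullet φ => φ.nablaFree

end Formula

/-- L(•) is not at least as expressive as L(∇) over the class of models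
satisfying C: some L(•)-formula has no L(∇) equivalent over that class. -/
def BulletNotLeqNabla (C : NbhdModel → Prop) : Prop :=
  ∃ φ : Formula, φ.nablaFree ∧
    ∀ ψ : Formula, ψ.bulletFree →
      ¬ ∀ (M : NbhdModel), C M → ∀ s : M.S, (M.Sat s φ ↔ M.Sat s ψ)

/-- L(∇) is not at least as expressive as L(•) over the class of models
satisfying C: some L(∇)-formula has no L(•) equivalent over that class. -/
def NablaNotLeqBullet (C : NbhdModel → Prop) : Prop :=
  ∃ φ : Formula, φ.bulletFree ∧
    ∀ ψ : Formula, ψ.nablaFree →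
      ¬ ∀ (M : NbhdModel), C M → ∀ s : M.S, (M.Sat s φ ↔ M.Sat s ψ)

/-- The two-point model in which every state has the principal ultrafilter at `b` as its
neighborhood family, and every variable is true exactly at `true`. -/
def principalModel (b : Bool) : NbhdModel where
  S := Bool
  ne := ⟨true⟩
  N := fun _ => {X | b ∈ X}
  V := fun _ => {true}

namespace principalModel

theorem truthSet_nabla (b : Bool) (φ : Formula) :
    (principalModel b).truthSet φ.nabla = ∅ :=
  Set.eq_empty_of_forall_notMem fun _ h => h.2 h.1

theorem truthSet_eq_of_bulletFree (b c : Bool) {φ : Formula} (h : φ.bulletFree) :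
    ((principalModel b).truthSet φ : Set Bool) = (principalModel c).truthSet φ := by
  induction φ with
  | atom p => rfl
  | neg φ ih => exact congrArg (fun X : Set Bool => Xᶜ) (ih h)
  | and φ ψ ihφ ihψ => exact congrArg₂ (fun X Y : Set Bool => X ∩ Y) (ihφ h.1) (ihψ h.2)
  | nabla φ => exact (truthSet_nabla b φ).trans (truthSet_nabla c φ).symm
  | bullet φ => exact h.elim

theorem propR (b : Bool) : (principalModel b).PropR :=
  fun _ _ hX => hX

theorem propI (b : Bool) : (principalModel b).PropI :=
  fun _ _ _ hX hY => ⟨hX, hY⟩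

theorem propS (b : Bool) : (principalModel b).PropS :=
  fun _ _ _ hX hXY => hXY hX

theorem propD (b : Bool) : (principalModel b).PropD :=
  fun _ _ hX hXc => hXc hX

theorem sat_bullet_atom (p : ℕ) :
    (principalModel false).Sat true (Formula.atom p).bullet :=
  ⟨rfl, fun h => Bool.false_ne_true h⟩

theorem not_sat_bullet_atom (p : ℕ) :
    ¬ (principalModel true).Sat true (Formula.atom p).bullet :=
  fun h => h.2 rfl

end principalModel

theorem bulletNotLeqNabla_of_principalModel {C : NbhdModel → Prop}
    (hC : ∀ b, C (principalModel b)) : BulletNotLeqNabla C := by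
  refine ⟨(Formula.atom 0).bullet, trivial, fun ψ hψ h => ?_⟩
  have hsat := (h _ (hC false) true).1 (principalModel.sat_bullet_atom 0)
  refine principalModel.not_sat_bullet_atom 0 ((h _ (hC true) true).2 ?_)
  exact (principalModel.truthSet_eq_of_bulletFree false true hψ).subset hsat

/-- L(•) ⋠ L(∇) over the class of all models and over the
classes of (r)-, (i)-, (s)-, and (d)-models. -/
theorem bullet_not_leq_nabla_all_r_i_s_d :
    BulletNotLeqNabla (fun _ => True) ∧
    BulletNotLeqNabla NbhdModel.PropR ∧
    BulletNotLeqNabla NbhdModel.PropI ∧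
    BulletNotLeqNabla NbhdModel.PropS ∧
    BulletNotLeqNabla NbhdModel.PropD :=
  ⟨bulletNotLeqNabla_of_principalModel fun _ => trivial,
    bulletNotLeqNabla_of_principalModel principalModel.propR,
    bulletNotLeqNabla_of_principalModel principalModel.propI,
    bulletNotLeqNabla_of_principalModel principalModel.propS,
    bulletNotLeqNabla_of_principalModel principalModel.propD⟩
end

section
/- The language L(•) is not at least as expressive as the language L(∇) over the class of (n)-models, nor over the class of (b)-models, nor over the class of (4)-models, nor over the class of (5)-models: for each such class C there exists an L(•)-formula φ such that no L(∇)-formula ψ satisfies M,s ⊨ φ ⟺ M,s ⊨ ψ for all models M ∈ C and all states s of M. -/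
/-- Truth sets of •-free formulas depend on a neighborhood function only through which sets `X`
satisfy `X ∈ N s ∨ Xᶜ ∈ N s`. -/
theorem truthSet_eq_of_bulletFree {S : Type} (ne : Nonempty S) (N N' : S → Set (Set S))
    (V : ℕ → Set S) (h : ∀ s X, (X ∈ N s ∨ Xᶜ ∈ N s) ↔ (X ∈ N' s ∨ Xᶜ ∈ N' s)) (ψ : Formula)
    (hψ : ψ.bulletFree) :
    NbhdModel.truthSet ⟨S, ne, N, V⟩ ψ = NbhdModel.truthSet ⟨S, ne, N', V⟩ ψ := by
  induction ψ with
  | atom p => rfl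
  | neg φ ih => simp only [NbhdModel.truthSet, ih hψ]
  | and φ χ ihφ ihχ => simp only [NbhdModel.truthSet, ihφ hψ.1, ihχ hψ.2]
  | nabla φ ih =>
    simp only [NbhdModel.truthSet, ih hψ, ← not_or]
    ext s
    exact not_congr (h s _)
  | bullet φ => exact hψ.elim

/-- The two-point model in which every atom holds exactly at `true` and the neighborhoods of
every state are `∅`, the whole space and `{b}`. -/
def twoPointModel (b : Bool) : NbhdModel where
  S := Bool
  ne := inferInstance
  N _ := {∅, Set.univ, {b}}
  V _ := {true}

theorem twoPointModel_propN (b : Bool) : (twoPointModel b).PropN := fun _ =>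
  Or.inr (Or.inl rfl)

theorem setOf_const_mem_twoPointModel_N (b : Bool) (s : (twoPointModel b).S) (P : Prop) :
    {_u : (twoPointModel b).S | P} ∈ (twoPointModel b).N s := by
  by_cases hP : P
  · exact Or.inr (Or.inl (Set.eq_univ_of_forall fun _ => hP))
  · exact Or.inl (Set.eq_empty_of_forall_notMem fun _ => hP)

theorem twoPointModel_propB (b : Bool) : (twoPointModel b).PropB := fun s X _ =>
  setOf_const_mem_twoPointModel_N b s (Xᶜ ∉ (twoPointModel b).N s)

theorem twoPointModel_prop4 (b : Bool) : (twoPointModel b).Prop4 := fun s X _ =>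
  setOf_const_mem_twoPointModel_N b s (X ∈ (twoPointModel b).N s)

theorem twoPointModel_prop5 (b : Bool) : (twoPointModel b).Prop5 := fun s X _ =>
  setOf_const_mem_twoPointModel_N b s (X ∉ (twoPointModel b).N s)

theorem mem_or_compl_mem_twoPointModel_N (b : Bool) (s : Bool) (X : Set Bool) :
    X ∈ (twoPointModel b).N s ∨ Xᶜ ∈ (twoPointModel b).N s := by
  change (X = ∅ ∨ X = Set.univ ∨ X = {b}) ∨ (Xᶜ = ∅ ∨ Xᶜ = Set.univ ∨ Xᶜ = {b})
  by_cases ht : true ∈ X <;> by_cases hf : false ∈ X <;> cases b <;>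
    simp [Set.ext_iff, ht, hf]

theorem twoPointModel_sat_bullet_atom_iff (b : Bool) :
    (twoPointModel b).Sat true (.bullet (.atom 0)) ↔ b = false := by
  change (true ∈ ({true} : Set Bool) ∧
    ¬ (({true} : Set Bool) = ∅ ∨ ({true} : Set Bool) = Set.univ ∨ ({true} : Set Bool) = {b})) ↔ _
  cases b <;> simp [Set.ext_iff]

theorem bulletNotLeqNabla_of_twoPointModel (C : NbhdModel → Prop)
    (hC : ∀ b, C (twoPointModel b)) : BulletNotLeqNabla C := by
  refine ⟨.bullet (.atom 0), trivial, fun ψ hψ h => ?_⟩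
  have key : (twoPointModel true).Sat true ψ ↔ (twoPointModel false).Sat true ψ :=
    iff_of_eq (congrArg (fun X : Set Bool => true ∈ X)
      (truthSet_eq_of_bulletFree (S := Bool) inferInstance (twoPointModel true).N (twoPointModel false).N
        (fun _ => {true}) (fun s X => iff_of_true (mem_or_compl_mem_twoPointModel_N true s X)
          (mem_or_compl_mem_twoPointModel_N false s X)) ψ hψ))
  have hfalse := (twoPointModel_sat_bullet_atom_iff false).2 rfl
  have htrue := (h _ (hC true) true).2 (key.2 ((h _ (hC false) true).1 hfalse))
  exact absurd ((twoPointModel_sat_bullet_atom_iff true).1 htrue) (by decide)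

/-- L(•) ⋠ L(∇) over the classes of (n)-, (b)-, (4)-, and
(5)-models. -/
theorem bullet_not_leq_nabla_n_b_4_5 :
    BulletNotLeqNabla NbhdModel.PropN ∧
    BulletNotLeqNabla NbhdModel.PropB ∧
    BulletNotLeqNabla NbhdModel.Prop4 ∧
    BulletNotLeqNabla NbhdModel.Prop5 :=
  ⟨bulletNotLeqNabla_of_twoPointModel _ twoPointModel_propN,
    bulletNotLeqNabla_of_twoPointModel _ twoPointModel_propB,
    bulletNotLeqNabla_of_twoPointModel _ twoPointModel_prop4,
    bulletNotLeqNabla_of_twoPointModel _ twoPointModel_prop5⟩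
end

section
/- The language L(∇) is not at least as expressive as the language L(•) over the class of all neighborhood models, nor over any of the classes of (n)-, (r)-, (i)-, (s)-, (d)-, (b)-, (4)-, or (5)-models: for each such class C there exists an L(∇)-formula φ such that no L(•)-formula ψ satisfies M,s ⊨ φ ⟺ M,s ⊨ ψ for all models M ∈ C and all states s of M. -/
/-- L(•)-formulas at a state s only depend on which neighborhoods of s contain s. -/
theorem NbhdModel.truthSet_eq_of_nablaFree {S : Type} {ne : Nonempty S} {N N' : S → Set (Set S)}
    {V : ℕ → Set S} (h : ∀ s X, s ∈ X → (X ∈ N s ↔ X ∈ N' s)) (ψ : Formula) (hψ : ψ.nablaFree) :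
    truthSet ⟨S, ne, N, V⟩ ψ = truthSet ⟨S, ne, N', V⟩ ψ := by
  induction ψ with
  | atom p => rfl
  | neg φ ih => simp only [truthSet, ih hψ]
  | and φ ψ ih₁ ih₂ => simp only [truthSet, ih₁ hψ.1, ih₂ hψ.2]
  | nabla φ _ => exact hψ.elim
  | bullet φ ih =>
    ext s
    simp only [truthSet, ih hψ, Set.mem_ofPred_eq]
    exact and_congr_right fun hs => not_congr (h s _ hs)

/-- Two models in C differing only in neighborhoods of s that omit s, but disagreeing on ∇p,
separate L(∇) from L(•). -/
theorem NablaNotLeqBullet.of_models {C : NbhdModel → Prop} {S : Type} {ne : Nonempty S}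
    {N N' : S → Set (Set S)} {V : ℕ → Set S}
    (h : ∀ s X, s ∈ X → (X ∈ N s ↔ X ∈ N' s))
    (hC : C ⟨S, ne, N, V⟩) (hC' : C ⟨S, ne, N', V⟩) (s : S) (p : ℕ)
    (hs : V p ∉ N s ∧ (V p)ᶜ ∉ N s) (hs' : (V p)ᶜ ∈ N' s) : NablaNotLeqBullet C := by
  refine ⟨.nabla (.atom p), trivial, fun ψ hψ H => ?_⟩
  have h₁ := (H _ hC s).1 hs
  rw [NbhdModel.Sat, NbhdModel.truthSet_eq_of_nablaFree h ψ hψ] at h₁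
  exact ((H _ hC' s).2 h₁).2 hs'

namespace NbhdModel

/-- The neighborhoods of b are the sets containing both `false` and b. -/
abbrev filterModel : NbhdModel :=
  ⟨Bool, inferInstance, fun b => {X | false ∈ X ∧ b ∈ X}, fun _ => {true}⟩

/-- The neighborhoods of every state are the sets containing `false`. -/
abbrev constFilterModel : NbhdModel :=
  ⟨Bool, inferInstance, fun _ => {X | false ∈ X}, fun _ => {true}⟩

/-- The only neighborhood of `true` is its singleton; every set is a neighborhood of `false`. -/
abbrev singletonModel : NbhdModel :=
  ⟨Bool, inferInstance, fun b => {X | b = true → true ∈ X ∧ false ∉ X}, fun _ => Set.univ⟩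

/-- The neighborhoods of `true` are its singleton and ∅; every set is a neighborhood of `false`. -/
abbrev subsingletonModel : NbhdModel :=
  ⟨Bool, inferInstance, fun b => {X | b = true → false ∉ X}, fun _ => Set.univ⟩

end NbhdModel

open NbhdModel in
theorem NablaNotLeqBullet.of_filterModel {C : NbhdModel → Prop} (hC : C filterModel)
    (hC' : C constFilterModel) : NablaNotLeqBullet C :=
  .of_models (by simp +contextual) hC hC' true 0 (by simp) (by simp)

open NbhdModel in
theorem NablaNotLeqBullet.of_singletonModel {C : NbhdModel → Prop} (hC : C singletonModel)
    (hC' : C subsingletonModel) : NablaNotLeqBullet C :=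
  .of_models (by simp +contextual) hC hC' true 0 (by simp) (by simp)

/-- L(∇) ⋠ L(•) over the class of all models and over the
classes of (n)-, (r)-, (i)-, (s)-, (d)-, (b)-, (4)-, and (5)-models. -/
theorem nabla_not_leq_bullet :
    NablaNotLeqBullet (fun _ => True) ∧
    NablaNotLeqBullet NbhdModel.PropN ∧
    NablaNotLeqBullet NbhdModel.PropR ∧
    NablaNotLeqBullet NbhdModel.PropI ∧
    NablaNotLeqBullet NbhdModel.PropS ∧
    NablaNotLeqBullet NbhdModel.PropD ∧
    NablaNotLeqBullet NbhdModel.PropB ∧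
    NablaNotLeqBullet NbhdModel.Prop4 ∧
    NablaNotLeqBullet NbhdModel.Prop5 := by
  refine ⟨.of_filterModel trivial trivial, .of_filterModel ?_ ?_, .of_filterModel ?_ ?_,
    .of_filterModel ?_ ?_, .of_filterModel ?_ ?_, .of_filterModel ?_ ?_,
    .of_singletonModel ?_ ?_, .of_filterModel ?_ ?_, .of_singletonModel ?_ ?_⟩
  · simp [NbhdModel.PropN]
  · simp [NbhdModel.PropN]
  · simp +contextual [NbhdModel.PropR]
  · simp +contextual [NbhdModel.PropR]
  · simp +contextual [NbhdModel.PropI]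
  · simp +contextual [NbhdModel.PropI]
  · exact fun _ _ _ h hXY => ⟨hXY h.1, hXY h.2⟩
  · exact fun _ _ _ h hXY => hXY h
  · simp +contextual [NbhdModel.PropD]
  · simp +contextual [NbhdModel.PropD]
  · simp +contextual [NbhdModel.PropB]
  · simp +contextual [NbhdModel.PropB]
  · simp +contextual [NbhdModel.Prop4]
  · simp +contextual [NbhdModel.Prop4]
  · simp +contextual [NbhdModel.Prop5]
  · simp +contextual [NbhdModel.Prop5]
end
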